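/- (Lemma 2.1, condition SI-2 for W(n)) Let n ≥ 2, X ∈ W(n)_{[1]} and Y ∈ W(n)_{[−1]}. Then (a) [X,[Y,Z]] ∈ W(n)_{[0]} for every Z ∈ W(n)_{[0]}, so that ad X ∘ ad Y restricts to a linear endomorphism φ of the finite-dimensional space W(n)_{[0]}; and (b) div([X,Y]) is the constant polynomial whose value equals tr(φ). Equivalently, E_W([X,Y]) = tr((ad X ∘ ad Y)|_{W(n)_{[0]}}), where E_W : W(n)_{[0]} → F is the linear functional with E_W(x_i∂_j) = δ_{ij}. -/

import Mathlib

open MvPolynomial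

noncomputable section

abbrev Wn (F : Type*) [Field F] (n : ℕ) :=
  Derivation F (MvPolynomial (Fin n) F) (MvPolynomial (Fin n) F)

/-- The submodule of polynomials homogeneous of integer degree `d`
(for `d < 0` this is `⊥`). -/
def homZ (F : Type*) [Field F] (n : ℕ) (d : ℤ) : Submodule F (MvPolynomial (Fin n) F) where
  carrier := {p | ∀ m : Fin n →₀ ℕ, coeff m p ≠ 0 → (m.sum fun _ e => (e : ℤ)) = d}
  zero_mem' := by intro m hm; simp at hm
  add_mem' := by
    intro p q hp hq m hm
    by_cases h : coeff m p = 0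
    · refine hq m fun hq0 => hm ?_
      simp [coeff_add, h, hq0]
    · exact hp m h
  smul_mem' := by
    intro c p hp m hm
    refine hp m fun h => hm ?_
    simp [coeff_smul, h]

/-- The homogeneous component `W(n)_{[i]}`. -/
def Wgr (F : Type*) [Field F] (n : ℕ) (i : ℤ) : Submodule F (Wn F n) where
  carrier := {D | ∀ k, D (X k) ∈ homZ F n (i + 1)}
  zero_mem' := by intro k; simp
  add_mem' := by intro D E hD hE k; simpa using add_mem (hD k) (hE k)
  smul_mem' := by intro c D hD k; simpa using Submodule.smul_mem _ c (hD k)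


/-- The divergence of a polynomial vector field. -/
def divg {F : Type*} [Field F] {n : ℕ} (D : Wn F n) : MvPolynomial (Fin n) F :=
  ∑ i, pderiv i (D (X i))

theorem homZ_natCast {F : Type*} [Field F] {n d : ℕ} {p : MvPolynomial (Fin n) F} :
    p ∈ homZ F n (d : ℤ) ↔ p.IsHomogeneous d := by
  have hdeg (m : Fin n →₀ ℕ) : (m.sum fun _ e => (e : ℤ)) = ((m.degree : ℕ) : ℤ) := by
    simp [Finsupp.sum, Finsupp.degree_apply]
  change (∀ m : Fin n →₀ ℕ, coeff m p ≠ 0 → (m.sum fun _ e => (e : ℤ)) = d) ↔ _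
  simp only [hdeg, Nat.cast_inj]
  refine forall_congr' fun m => ?_
  rw [Finsupp.degree_eq_weight_one]
  rfl

theorem mem_Wgr_iff {F : Type*} [Field F] {n : ℕ} {i : ℤ} {d : ℕ} (hd : i + 1 = d) {D : Wn F n} :
    D ∈ Wgr F n i ↔ ∀ k, (D (X k)).IsHomogeneous d := by
  simp only [← homZ_natCast, ← hd]
  rfl

theorem eq_C_of_isHomogeneous_zero {F : Type*} [Field F] {n : ℕ} {p : MvPolynomial (Fin n) F}
    (hp : p.IsHomogeneous 0) : p = C (coeff 0 p) :=
  totalDegree_eq_zero_iff_eq_C.mp (Nat.le_zero.mp hp.totalDegree_le)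

theorem pderiv_eq_C_of_isHomogeneous_one {F : Type*} [Field F] {n : ℕ}
    {p : MvPolynomial (Fin n) F} (hp : p.IsHomogeneous 1) (l : Fin n) :
    pderiv l p = C (coeff (Finsupp.single l 1) p) := by
  rw [eq_C_of_isHomogeneous_zero hp.pderiv, coeff_pderiv]
  simp

theorem eq_sum_of_isHomogeneous_one {F : Type*} [Field F] {n : ℕ}
    {p : MvPolynomial (Fin n) F} (hp : p.IsHomogeneous 1) :
    p = ∑ l, C (coeff (Finsupp.single l 1) p) * X l := by
  have h := hp.sum_X_mul_pderiv
  simp only [pderiv_eq_C_of_isHomogeneous_one hp, one_smul] at h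
  rw [← h]
  simp only [h, mul_comm]

theorem derivation_apply_eq_sum {F : Type*} [Field F] {n : ℕ} (D : Wn F n)
    (p : MvPolynomial (Fin n) F) : D p = ∑ i, pderiv i p * D (X i) := by
  have hsum (q : MvPolynomial (Fin n) F) :
      (∑ i, D (X i) • pderiv i : Wn F n) q = ∑ i, pderiv i q * D (X i) := by
    rw [← Derivation.coeFnAddMonoidHom_apply, map_sum, Finset.sum_apply]
    simp [mul_comm]
  have h : D = ∑ i, D (X i) • pderiv i := by
    refine derivation_ext fun k => ?_
    rw [hsum]
    simp [pderiv_X, Pi.single_apply]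
  rw [← hsum, ← h]

/-- A linear vector field is determined by the matrix of its linear coefficients. -/
def linearFieldEquiv (F : Type*) [Field F] (n : ℕ) : ↥(Wgr F n 0) ≃ₗ[F] (Fin n × Fin n → F) where
  toFun D q := coeff (Finsupp.single q.2 1) (D.1 (X q.1))
  map_add' D E := by ext q; simp
  map_smul' c D := by ext q; simp
  invFun a := ⟨mkDerivation F fun i => ∑ l, C (a (i, l)) * X l, by
    rw [mem_Wgr_iff (d := 1) (by simp)]
    intro k
    rw [mkDerivation_X]
    refine IsHomogeneous.sum _ _ _ fun l _ => ?_
    simpa using (isHomogeneous_C (Fin n) (a (k, l))).mul (isHomogeneous_X F l)⟩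
  left_inv D := by
    refine Subtype.ext (derivation_ext fun k => ?_)
    rw [mkDerivation_X]
    exact (eq_sum_of_isHomogeneous_one ((mem_Wgr_iff (d := 1) (by simp)).mp D.2 k)).symm
  right_inv a := by
    ext q
    simp [mkDerivation_X, coeff_sum, coeff_C_mul, coeff_X, Finsupp.single_left_inj]

/-- The basis `x_l ∂_i` of the linear vector fields, indexed by the pairs `(i, l)`. -/
def linearFieldBasis (F : Type*) [Field F] (n : ℕ) :
    Module.Basis (Fin n × Fin n) F ↥(Wgr F n 0) :=
  Module.Basis.ofEquivFun (linearFieldEquiv F n)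

theorem linearFieldBasis_apply_X {F : Type*} [Field F] {n : ℕ} (q : Fin n × Fin n) (k : Fin n) :
    (linearFieldBasis F n q).1 (X k) = if k = q.1 then X q.2 else 0 := by
  rw [linearFieldBasis, Module.Basis.coe_ofEquivFun]
  change mkDerivation F _ (X k) = _
  rw [mkDerivation_X]
  obtain ⟨i, l⟩ := q
  by_cases hk : k = i <;> simp [hk, Pi.single_apply, apply_ite]

theorem lie_lie_apply_X {F : Type*} [Field F] {n : ℕ} {D E Z : Wn F n}
    (hE : E ∈ Wgr F n (-1)) (hZ : Z ∈ Wgr F n 0) (i : Fin n) :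
    ⁅D, ⁅E, Z⁆⁆ (X i) = -∑ k, pderiv k (D (X i)) * E (Z (X k)) := by
  have hE0 := (mem_Wgr_iff (d := 0) (by simp)).mp hE
  have hZ1 := (mem_Wgr_iff (d := 1) (by simp)).mp hZ
  have hEZ (k : Fin n) : ⁅E, Z⁆ (X k) = E (Z (X k)) := by
    rw [Derivation.commutator_apply, eq_C_of_isHomogeneous_zero (hE0 k), derivation_C, sub_zero]
  have hconst : (E (Z (X i))).IsHomogeneous 0 := by
    rw [derivation_apply_eq_sum]
    exact IsHomogeneous.sum _ _ _ fun k _ => (hZ1 i).pderiv.mul (hE0 k)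
  rw [Derivation.commutator_apply, hEZ, eq_C_of_isHomogeneous_zero hconst, derivation_C, zero_sub,
    derivation_apply_eq_sum]
  simp only [hEZ]

theorem lie_lie_mem_Wgr_zero {F : Type*} [Field F] {n : ℕ} {D E Z : Wn F n}
    (hD : D ∈ Wgr F n 1) (hE : E ∈ Wgr F n (-1)) (hZ : Z ∈ Wgr F n 0) :
    ⁅D, ⁅E, Z⁆⁆ ∈ Wgr F n 0 := by
  have hE0 := (mem_Wgr_iff (d := 0) (by simp)).mp hE
  have hZ1 := (mem_Wgr_iff (d := 1) (by simp)).mp hZ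
  have hD2 := (mem_Wgr_iff (d := 2) (by norm_num)).mp hD
  rw [mem_Wgr_iff (d := 1) (by simp)]
  intro i
  rw [lie_lie_apply_X hE hZ]
  refine (IsHomogeneous.sum _ _ _ fun k _ => (hD2 i).pderiv.mul (n := 0) ?_).neg
  rw [derivation_apply_eq_sum]
  exact IsHomogeneous.sum _ _ _ fun l _ => (hZ1 k).pderiv.mul (hE0 l)

theorem divg_lie_eq_sum {F : Type*} [Field F] {n : ℕ} {D E : Wn F n}
    (hD : D ∈ Wgr F n 1) (hE : E ∈ Wgr F n (-1)) :
    divg ⁅D, E⁆ = ∑ i, ∑ l,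
      C (-(coeff (Finsupp.single l 1) (pderiv i (D (X i))) * coeff 0 (E (X l)))) := by
  have hE0 := (mem_Wgr_iff (d := 0) (by simp)).mp hE
  have hD2 := (mem_Wgr_iff (d := 2) (by norm_num)).mp hD
  refine Finset.sum_congr rfl fun i _ => ?_
  rw [Derivation.commutator_apply, eq_C_of_isHomogeneous_zero (hE0 i), derivation_C,
    zero_sub, derivation_apply_eq_sum E, map_neg, map_sum, ← Finset.sum_neg_distrib]
  refine Finset.sum_congr rfl fun l _ => ?_
  have hcomm : pderiv i (pderiv l (D (X i))) = pderiv l (pderiv i (D (X i))) := by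
    have h : ⁅(pderiv i : Wn F n), (pderiv l : Wn F n)⁆ = 0 :=
      derivation_ext fun k => by
        rw [Derivation.commutator_apply]
        simp [pderiv_X, Pi.single_apply, apply_ite]
    exact sub_eq_zero.mp (by rw [← Derivation.commutator_apply, h, Derivation.zero_apply])
  conv_lhs => rw [eq_C_of_isHomogeneous_zero (hE0 l)]
  rw [Derivation.leibniz, pderiv_C, smul_zero, zero_add, hcomm,
    pderiv_eq_C_of_isHomogeneous_one (hD2 i).pderiv]
  simp [mul_comm]


/-- for `n ≥ 2`, `X ∈ W(n)_{[1]}`, `Y ∈ W(n)_{[−1]}`: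
(a) `ad X ∘ ad Y` preserves `W(n)_{[0]}`, hence restricts to an endomorphism
`φ` of `W(n)_{[0]}`; (b) `div([X,Y])` is the constant polynomial with value
`tr(φ)` (i.e. `E_W([X,Y]) = tr((ad X ∘ ad Y)|_{W(n)_{[0]}})`). -/
theorem stmt13 (F : Type*) [Field F] [CharZero F] (n : ℕ) (hn : 2 ≤ n)
    (X Y : Wn F n) (hX : X ∈ Wgr F n 1) (hY : Y ∈ Wgr F n (-1)) :
    ∃ h : ∀ z ∈ Wgr F n 0,
        ((LieAlgebra.ad F (Wn F n) X) ∘ₗ (LieAlgebra.ad F (Wn F n) Y)) z ∈ Wgr F n 0,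
      divg ⁅X, Y⁆ =
        MvPolynomial.C (LinearMap.trace F ↥(Wgr F n 0)
          (LinearMap.restrict ((LieAlgebra.ad F (Wn F n) X) ∘ₗ
            (LieAlgebra.ad F (Wn F n) Y)) h)) := by
  refine ⟨fun z hz => lie_lie_mem_Wgr_zero hX hY hz, ?_⟩
  rw [divg_lie_eq_sum hX hY, LinearMap.trace_eq_matrix_trace F (linearFieldBasis F n),
    Matrix.trace, Fintype.sum_prod_type]
  simp only [map_sum]
  refine Finset.sum_congr rfl fun i _ => Finset.sum_congr rfl fun l _ => congrArg C ?_
  rw [Matrix.diag_apply, LinearMap.toMatrix_apply]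
  change _ = coeff (Finsupp.single l 1)
    (⁅X, ⁅Y, (linearFieldBasis F n (i, l)).1⁆⁆ (MvPolynomial.X i))
  rw [lie_lie_apply_X hY (linearFieldBasis F n (i, l)).2, Finset.sum_eq_single i]
  · rw [linearFieldBasis_apply_X, if_pos rfl]
    conv_rhs => rw [eq_C_of_isHomogeneous_zero ((mem_Wgr_iff (d := 0) (by simp)).mp hY l)]
    rw [coeff_neg, mul_comm (pderiv i _), coeff_C_mul, mul_comm]
  · intro k _ hk
    rw [linearFieldBasis_apply_X, if_neg hk, map_zero, mul_zero]
  · simp
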